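/- Let R_i be a partial row over m candidates in normal form of parameters k_1 and k_2 with k_1 > 0, and suppose the fixed candidate w is locked at position 1 (R_{i,1} = w). Then the total score margin of w satisfies Δ(R_i) = (k_1 + k_2)·(m − (k_1 + k_2 + 1)/2), equivalently 2·Δ(R_i) = (k_1 + k_2)·(2m − k_1 − k_2 − 1). -/

import Mathlib

section Defs

variable {n m : ℕ} {C : Type*}

/-- A partial row (partial ballot): each candidate appears at most once. -/
def IsPartialRow (r : Fin m → Option C) : Prop :=
  ∀ ⦃k k' : Fin m⦄ ⦃c : C⦄, r k = some c → r k' = some c → k = k'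

/-- `q` is a completion of the partial row `r` (a bijection from positions to
candidates agreeing with `r` on all non-null entries). -/
def IsCompletion (r : Fin m → Option C) (q : Fin m ≃ C) : Prop :=
  ∀ ⦃k : Fin m⦄ ⦃c : C⦄, r k = some c → q k = c

/-- Number of non-null (locked) entries of a partial row. -/
def rowSize (r : Fin m → Option C) : ℕ :=
  (Finset.univ.filter fun k : Fin m => (r k).isSome).card

/-- A partial rank matrix: each candidate appears at most once in every row. -/
def IsPartialMat (R : Fin n → Fin m → Option C) : Prop :=
  ∀ i, IsPartialRow (R i)

/-- `Q` is a complete extension of the partial rank matrix `R`: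
each row of `Q` is a bijection from positions to candidates
agreeing with the corresponding row of `R` on all non-null entries. -/
def IsMatCompletion (R : Fin n → Fin m → Option C) (Q : Fin n → Fin m ≃ C) : Prop :=
  ∀ i, IsCompletion (R i) (Q i)

/-- Number of non-null (locked) entries of a partial rank matrix. -/
def matSize (R : Fin n → Fin m → Option C) : ℕ := ∑ i, rowSize (R i)

/-- `R ⊆ R'` : the partial rank matrix `R'` extends the partial rank matrix `R`. -/
def PExt (R R' : Fin n → Fin m → Option C) : Prop :=
  ∀ i k c, R i k = some c → R' i k = some c

/-- `w` is a necessary winner of the partial rank matrix `X` under voting rule `F`. -/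
def NecessaryWinner (F : (Fin n → Fin m ≃ C) → Set C)
    (X : Fin n → Fin m → Option C) (w : C) : Prop :=
  ∀ Q : Fin n → Fin m ≃ C, IsMatCompletion X Q → w ∈ F Q

/-- `R∖Y` : the partial rank matrix obtained from the complete rank matrix `R` by
erasing (making null) the entries locked in `Y`. -/
def matDiff (R : Fin n → Fin m ≃ C) (Y : Fin n → Fin m → Option C) :
    Fin n → Fin m → Option C :=
  fun i k => if (Y i k).isSome then none else some (R i k)

/-- Borda score of candidate `c` in the complete row `q` :
a candidate in position `k+1` (index `k`) scores `m - (k+1)`. -/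
def bordaRowScore (q : Fin m ≃ C) (c : C) : ℤ := (m : ℤ) - 1 - ((q.symm c : ℕ) : ℤ)

/-- Minimal Borda score of `c` over all completions of the partial row `r`. -/
noncomputable def rowSMin (r : Fin m → Option C) (c : C) : ℤ :=
  sInf {x : ℤ | ∃ q : Fin m ≃ C, IsCompletion r q ∧ bordaRowScore q c = x}

/-- Maximal Borda score of `c` over all completions of the partial row `r`. -/
noncomputable def rowSMax (r : Fin m → Option C) (c : C) : ℤ :=
  sSup {x : ℤ | ∃ q : Fin m ≃ C, IsCompletion r q ∧ bordaRowScore q c = x}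

/-- Total score margin `Δ(r) = Σ_{c' ≠ w} (σmin_r(w) − σmax_r(c'))` of `w` in the
partial row `r`, under Borda weights. -/
noncomputable def rowDelta [Fintype C] [DecidableEq C]
    (r : Fin m → Option C) (w : C) : ℤ :=
  ∑ c ∈ Finset.univ.filter (fun c : C => c ≠ w), (rowSMin r w - rowSMax r c)

/-- Borda score of candidate `c` in the complete rank matrix `Q`. -/
def bordaScore (Q : Fin n → Fin m ≃ C) (c : C) : ℤ := ∑ i, bordaRowScore (Q i) c

/-- `w ∈ Borda(Q)` : `w` has maximal Borda score in the complete rank matrix `Q`. -/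
def IsBordaWinner (Q : Fin n → Fin m ≃ C) (w : C) : Prop :=
  ∀ c, bordaScore Q c ≤ bordaScore Q w

/-- Score of candidate `c` in the complete rank matrix `Q` under the scoring rule
with weight vector `wt`. -/
def scoreW (wt : Fin m → ℝ) (Q : Fin n → Fin m ≃ C) (c : C) : ℝ :=
  ∑ i, wt ((Q i).symm c)

/-- `σmin_R(c)` : minimal score of `c` over all complete extensions of `R`. -/
noncomputable def matSMinW (wt : Fin m → ℝ) (R : Fin n → Fin m → Option C) (c : C) : ℝ :=
  sInf {x : ℝ | ∃ Q : Fin n → Fin m ≃ C, IsMatCompletion R Q ∧ scoreW wt Q c = x}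

/-- `σmax_R(c)` : maximal score of `c` over all complete extensions of `R`. -/
noncomputable def matSMaxW (wt : Fin m → ℝ) (R : Fin n → Fin m → Option C) (c : C) : ℝ :=
  sSup {x : ℝ | ∃ Q : Fin n → Fin m ≃ C, IsMatCompletion R Q ∧ scoreW wt Q c = x}

/-- `σmin_{R_i}(c)` : minimal score of `c` over all completions of the single row `r`. -/
noncomputable def rowSMinW (wt : Fin m → ℝ) (r : Fin m → Option C) (c : C) : ℝ :=
  sInf {x : ℝ | ∃ q : Fin m ≃ C, IsCompletion r q ∧ wt (q.symm c) = x}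

/-- `σmax_{R_i}(c)` : maximal score of `c` over all completions of the single row `r`. -/
noncomputable def rowSMaxW (wt : Fin m → ℝ) (r : Fin m → Option C) (c : C) : ℝ :=
  sSup {x : ℝ | ∃ q : Fin m ≃ C, IsCompletion r q ∧ wt (q.symm c) = x}

/-- `r` is in normal form of parameters `k1, k2`: a position `p = k+1` is null
exactly when `k1 < p < m + 1 - k2`. -/
def IsNormalForm (r : Fin m → Option C) (k1 k2 : ℕ) : Prop :=
  ∀ k : Fin m, r k = none ↔ (k1 < (k : ℕ) + 1 ∧ (k : ℕ) + 1 < m + 1 - k2)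

end Defs

theorem IsPartialRow.exists_isCompletion {m : ℕ} {C : Type*} [Fintype C]
    (hC : Fintype.card C = m) {r : Fin m → Option C} (hr : IsPartialRow r) (w : C) :
    ∃ q : Fin m ≃ C, IsCompletion r q := by
  classical
  obtain ⟨g, hg⟩ := Set.MapsTo.exists_equiv_extend_of_card_eq
    (t := (Finset.univ : Finset C)) (s := {k : Fin m | r k ≠ none})
    (f := fun k => (r k).getD w) (by simp [hC]) (fun k _ => by simp) (by
      intro k hk k' hk' h
      obtain ⟨c, hc⟩ := Option.ne_none_iff_exists'.mp hk
      obtain ⟨c', hc'⟩ := Option.ne_none_iff_exists'.mp hk'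
      simp only [hc, hc', Option.getD_some] at h
      exact hr hc (h ▸ hc'))
  refine ⟨g.trans (Equiv.subtypeUnivEquiv Finset.mem_univ), fun k c hc => ?_⟩
  have := hg k (by simp [hc])
  simpa [hc] using this

theorem IsCompletion.symm_apply {m : ℕ} {C : Type*} {r : Fin m → Option C} {q : Fin m ≃ C}
    (hq : IsCompletion r q) {k : Fin m} {c : C} (hc : r k = some c) : q.symm c = k := by
  rw [← hq hc, q.symm_apply_apply]

theorem rowSMin_of_locked {m : ℕ} {C : Type*} {r : Fin m → Option C} {q : Fin m ≃ C}
    (hq : IsCompletion r q) {k : Fin m} {c : C} (hc : r k = some c) :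
    rowSMin r c = (m : ℤ) - 1 - (k : ℕ) := by
  refine IsLeast.csInf_eq ⟨⟨q, hq, ?_⟩, ?_⟩
  · rw [bordaRowScore, hq.symm_apply hc]
  · rintro x ⟨q', hq', rfl⟩
    rw [bordaRowScore, hq'.symm_apply hc]

theorem rowSMax_of_locked {m : ℕ} {C : Type*} {r : Fin m → Option C} {q : Fin m ≃ C}
    (hq : IsCompletion r q) {k : Fin m} {c : C} (hc : r k = some c) :
    rowSMax r c = (m : ℤ) - 1 - (k : ℕ) := by
  refine IsGreatest.csSup_eq ⟨⟨q, hq, ?_⟩, ?_⟩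
  · rw [bordaRowScore, hq.symm_apply hc]
  · rintro x ⟨q', hq', rfl⟩
    rw [bordaRowScore, hq'.symm_apply hc]

/-- A candidate that is not locked scores best when placed at the first null position. -/
theorem rowSMax_of_null {m : ℕ} {C : Type*} {r : Fin m → Option C} {q : Fin m ≃ C}
    (hq : IsCompletion r q) {k l : Fin m} (hk : r k = none) (hl : r l = none)
    (hmin : ∀ j, r j = none → l ≤ j) :
    rowSMax r (q k) = (m : ℤ) - 1 - (l : ℕ) := by
  refine IsGreatest.csSup_eq ⟨⟨(Equiv.swap k l).trans q, ?_, ?_⟩, ?_⟩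
  · intro j c hc
    have hjk : j ≠ k := by rintro rfl; simp [hk] at hc
    have hjl : j ≠ l := by rintro rfl; simp [hl] at hc
    simp [Equiv.swap_apply_of_ne_of_ne hjk hjl, hq hc]
  · simp [bordaRowScore]
  · rintro x ⟨q', hq', rfl⟩
    have hnull : r (q'.symm (q k)) = none := by
      by_contra h
      obtain ⟨c, hc⟩ := Option.ne_none_iff_exists'.mp h
      have h1 : c = q k := by rw [← hq' hc, q'.apply_symm_apply]
      have h2 := hq hc
      rw [h1, q.apply_eq_iff_eq] at h2
      rw [h2, hk] at hc
      simp at hc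
    have : (l : ℕ) ≤ q'.symm (q k) := hmin _ hnull
    rw [bordaRowScore]
    omega

theorem two_mul_sum_range_truncated (a d b : ℕ) :
    2 * ∑ k ∈ Finset.range (a + d + b), (if a ≤ k ∧ k < a + d then (a : ℤ) else k) =
      ((a : ℤ) + b) * (2 * ((a : ℤ) + d + b) - a - b - 1) := by
  induction b with
  | zero =>
    induction d with
    | zero =>
      have h : ∑ k ∈ Finset.range a, (if a ≤ k ∧ k < a + 0 then (a : ℤ) else k) =
          ∑ k ∈ Finset.range a, (k : ℤ) :=
        Finset.sum_congr rfl fun k _ => if_neg (by omega)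
      have h2 : 2 * ∑ k ∈ Finset.range a, (k : ℤ) = (a : ℤ) * (a - 1) := by
        clear h
        induction a with
        | zero => simp
        | succ n ih => rw [Finset.sum_range_succ, mul_add, ih]; push_cast; ring
      simp only [Nat.add_zero] at h ⊢
      rw [h, h2]
      push_cast
      ring
    | succ d ih =>
      have h : ∑ k ∈ Finset.range (a + d), (if a ≤ k ∧ k < a + (d + 1) then (a : ℤ) else k) =
          ∑ k ∈ Finset.range (a + d), (if a ≤ k ∧ k < a + d then (a : ℤ) else k) := by
        refine Finset.sum_congr rfl fun k hk => ?_
        rw [Finset.mem_range] at hk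
        congr 1
        simp only [eq_iff_iff]
        omega
      rw [Nat.add_zero] at ih ⊢
      rw [← Nat.add_assoc, Finset.sum_range_succ, Nat.add_assoc, h, if_pos (by omega), mul_add, ih]
      push_cast
      ring
  | succ b ih =>
    rw [← Nat.add_assoc, Finset.sum_range_succ, mul_add, ih, if_neg (by omega)]
    push_cast
    ring

/- STATEMENT 12 -/
theorem stmt12 {m : ℕ} {C : Type*} [Fintype C] [DecidableEq C]
    (hm : 2 ≤ m) (hC : Fintype.card C = m)
    (r : Fin m → Option C) (hr : IsPartialRow r) (w : C)
    (k1 k2 : ℕ) (hnf : IsNormalForm r k1 k2) (hk1 : 0 < k1) (hk : k1 + k2 ≤ m)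
    (hw : r ⟨0, by omega⟩ = some w) :
    2 * rowDelta r w = ((k1 : ℤ) + k2) * (2 * (m : ℤ) - k1 - k2 - 1) := by
  obtain ⟨q, hq⟩ := hr.exists_isCompletion hC w
  obtain ⟨d, hd⟩ : ∃ d, m = k1 + d + k2 := ⟨m - k1 - k2, by omega⟩
  have hmin : rowSMin r w = (m : ℤ) - 1 := by simpa using rowSMin_of_locked hq hw
  have hmax : rowSMax r w = (m : ℤ) - 1 := by simpa using rowSMax_of_locked hq hw
  have hterm (k : Fin m) : rowSMin r w - rowSMax r (q k) =
      if k1 ≤ (k : ℕ) ∧ (k : ℕ) < k1 + d then (k1 : ℤ) else (k : ℕ) := by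
    have hnull (j : Fin m) : r j = none ↔ k1 ≤ (j : ℕ) ∧ (j : ℕ) < k1 + d := by
      rw [hnf j]
      omega
    split_ifs with h
    · have hl : k1 < m := by omega
      rw [hmin, rowSMax_of_null hq (l := ⟨k1, hl⟩) ((hnull k).2 h) ((hnull _).2 (by simp; omega))
        fun j hj => ((hnull j).1 hj).1]
      simp
    · obtain ⟨c, hc⟩ := Option.ne_none_iff_exists'.mp (mt (hnull k).1 h)
      rw [hmin, hq hc, rowSMax_of_locked hq hc]
      simp
  have hsum : rowDelta r w = ∑ k ∈ Finset.range m,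
      (if k1 ≤ k ∧ k < k1 + d then (k1 : ℤ) else k) := by
    rw [rowDelta, Finset.sum_filter_of_ne, ← q.sum_comp, Finset.sum_congr rfl fun k _ => hterm k,
      Fin.sum_univ_eq_sum_range (fun k => if k1 ≤ k ∧ k < k1 + d then (k1 : ℤ) else k)]
    rintro c - hc rfl
    exact hc (by rw [hmin, hmax, sub_self])
  rw [hsum, hd, two_mul_sum_range_truncated]
  push_cast
  ring
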